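/- Let K be a differential field of characteristic zero with field of constants C, and let K ⊆ K(x) be an extension of differential fields with the same constants, where x is transcendental over K and x′ ∈ K. Let S = Σᵢ₌₀ˢ qᵢ xⁱ ∈ K[x] with qᵢ ∈ K and qₛ ≠ 0. If c·x′ + f′ ≠ qₛ for every c ∈ C and every f ∈ K, then there is no T ∈ K(x) with T′ = S. -/

import Mathlib

open Polynomial Differential IntermediateField

section PrimitiveExtension

variable {F L : Type*} [Field F] [Field L] [Algebra F L]

/-- Every element of a simple field extension `F⟮x⟯` is a quotient of coprime polynomials in `x`
with monic denominator. -/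
lemma exists_isCoprime_monic_of_mem_adjoin_simple {x T : L} (hT : T ∈ F⟮x⟯)
    (hx : Transcendental F x) :
    ∃ P Q : F[X], IsCoprime P Q ∧ Q.Monic ∧ T * aeval x Q = aeval x P := by
  obtain ⟨r, s, rfl⟩ := (mem_adjoin_simple_iff F T).1 hT
  rcases eq_or_ne s 0 with rfl | hs
  · exact ⟨0, 1, isCoprime_one_right, monic_one, by simp⟩
  obtain ⟨P, Q, c, hPQ, rfl, rfl⟩ := UniqueFactorizationMonoid.exists_reduced_factors' r s hs
  have hQ : Q ≠ 0 := right_ne_zero_of_mul hs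
  have hc : c ≠ 0 := left_ne_zero_of_mul hs
  have hx' : ∀ p : F[X], p ≠ 0 → aeval x p ≠ 0 := fun p hp h ↦ hx ⟨p, hp, h⟩
  have hu : IsUnit (C Q.leadingCoeff⁻¹) := isUnit_C.2 (by simp [hQ])
  refine ⟨P * C Q.leadingCoeff⁻¹, Q * C Q.leadingCoeff⁻¹, ?_, monic_mul_leadingCoeff_inv hQ, ?_⟩
  · exact (isCoprime_mul_unit_right hu P Q).2 hPQ.isCoprime
  · have h₁ := hx' c hc
    have h₂ := hx' Q hQ
    simp only [map_mul]
    field_simp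

variable [Differential L] [ContainConstants F L]

/-- A polynomial in a transcendental element which is a constant has degree zero. -/
lemma exists_eq_C_of_deriv_aeval_eq_zero {x : L} (hx : Transcendental F x) {p : F[X]}
    (hp : (aeval x p)′ = 0) : ∃ c, p = C c := by
  obtain ⟨c, hc⟩ := mem_range_of_deriv_eq_zero F hp
  exact ⟨c, transcendental_iff_injective.1 hx (by simp [hc])⟩

variable [Differential F]

lemma coeff_implicitDeriv_C (v : F) (p : F[X]) (i : ℕ) :
    (implicitDeriv (C v) p).coeff i = (p.coeff i)′ + v * (p.coeff (i + 1) * (i + 1)) := by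
  simp [implicitDeriv, coeff_derivative]

lemma Polynomial.Monic.degree_implicitDeriv_C_lt {p : F[X]} (hp : p.Monic) (v : F) :
    (implicitDeriv (C v) p).degree < p.degree := by
  rw [degree_eq_natDegree hp.ne_zero, degree_lt_iff_coeff_zero]
  intro m hm
  rw [coeff_implicitDeriv_C, coeff_eq_zero_of_natDegree_lt (Nat.lt_succ_of_le hm)]
  rcases hm.eq_or_lt with rfl | hm
  · simp [hp.coeff_natDegree]
  · simp [coeff_eq_zero_of_natDegree_lt hm]

lemma deriv_coeff_eq_zero_of_natDegree_implicitDeriv_lt {v : F} {p : F[X]} {m : ℕ}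
    (hp : p.natDegree ≤ m) (hm : (implicitDeriv (C v) p).natDegree < m) : (p.coeff m)′ = 0 := by
  have h := coeff_implicitDeriv_C v p m
  rw [coeff_eq_zero_of_natDegree_lt hm, coeff_eq_zero_of_natDegree_lt (n := m + 1) (by lia)] at h
  simpa using h.symm

variable [DifferentialAlgebra F L] {x : L} {v : F}

/-- In a primitive extension `F(x)` without new constants, an element whose derivative is a
polynomial in `x` is itself a polynomial in `x`. -/
lemma exists_aeval_eq_of_deriv_eq_aeval (hx : Transcendental F x) (hv : x′ = algebraMap F L v)
    {T : L} (hT : T ∈ F⟮x⟯) {S : F[X]} (hS : T′ = aeval x S) : ∃ P : F[X], aeval x P = T := by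
  obtain ⟨P, Q, hPQ, hQ, h⟩ := exists_isCoprime_monic_of_mem_adjoin_simple hT hx
  have hder := deriv_aeval_eq_implicitDeriv x (C v) (by simpa using hv)
  have key : implicitDeriv (C v) P * Q = S * Q * Q + P * implicitDeriv (C v) Q := by
    apply transcendental_iff_injective.1 hx
    have := congrArg (fun y ↦ y′) h
    simp only [Derivation.leibniz, smul_eq_mul, hder, hS] at this
    simp only [map_mul, map_add, ← this, ← h]
    ring
  have hdvd : Q ∣ implicitDeriv (C v) Q := by
    refine hPQ.symm.dvd_of_dvd_mul_left ((dvd_add_right (dvd_mul_left Q (S * Q))).1 ?_)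
    exact key ▸ dvd_mul_left Q _
  have hzero := eq_zero_of_dvd_of_degree_lt hdvd (hQ.degree_implicitDeriv_C_lt v)
  obtain ⟨c, rfl⟩ := exists_eq_C_of_deriv_aeval_eq_zero hx (p := Q) (by rw [hder, hzero, map_zero])
  have hc : c = 1 := by simpa using hQ.leadingCoeff
  exact ⟨P, by simpa [hc] using h.symm⟩

/-- If the derivative of `p` along `x′ = v` has degree at most `s`, then `p` has degree at most
`s + 1`. -/
lemma natDegree_le_of_natDegree_implicitDeriv_le [CharZero F] (hx : Transcendental F x)
    (hv : x′ = algebraMap F L v) {p : F[X]} {s : ℕ}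
    (hs : (implicitDeriv (C v) p).natDegree ≤ s) : p.natDegree ≤ s + 1 := by
  by_contra! hlt
  obtain ⟨n, hn⟩ : ∃ n, p.natDegree = n + 1 := ⟨p.natDegree - 1, by lia⟩
  have hlead : (p.coeff (n + 1))′ = 0 :=
    deriv_coeff_eq_zero_of_natDegree_implicitDeriv_lt (v := v) (by lia) (by lia)
  have hnext : (p.coeff n)′ + v * (p.coeff (n + 1) * (n + 1)) = 0 := by
    rw [← coeff_implicitDeriv_C, coeff_eq_zero_of_natDegree_lt (by lia)]
  have hconst : (aeval x (C (p.coeff (n + 1) * (n + 1)) * X + C (p.coeff n)))′ = 0 := by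
    rw [deriv_aeval_eq_implicitDeriv x (C v) (by simpa using hv)]
    have hcoeff : (p.coeff (n + 1) * ((n : F) + 1))′ = 0 := by simp [hlead]
    have hpoly : implicitDeriv (C v) (C (p.coeff (n + 1) * (n + 1)) * X + C (p.coeff n)) =
        C ((p.coeff n)′ + v * (p.coeff (n + 1) * (n + 1))) := by
      rw [map_add, Derivation.leibniz, implicitDeriv_C, implicitDeriv_C, implicitDeriv_X, hcoeff,
        C_0, smul_zero, add_zero, smul_eq_mul, ← C_mul, ← C_add, mul_comm, add_comm]
    rw [hpoly, hnext, map_zero, map_zero]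
  obtain ⟨c, hc⟩ := exists_eq_C_of_deriv_aeval_eq_zero hx hconst
  have h1 := congrArg (coeff · 1) hc
  have hne : p.coeff (n + 1) ≠ 0 := by
    rw [← hn]
    exact leadingCoeff_ne_zero.2 (by rintro rfl; simp at hn)
  simp [coeff_C, hne] at h1
  exact Nat.cast_add_one_ne_zero n h1

/-- If a polynomial in `x` of degree at most `s` has an integral in the primitive extension `F(x)`,
then its coefficient of degree `s` is of the form `c * x′ + f′` with `c` constant. -/
theorem exists_coeff_eq_of_deriv_eq_aeval [CharZero F] (hx : Transcendental F x)
    (hv : x′ = algebraMap F L v) {T : L} (hT : T ∈ F⟮x⟯) {S : F[X]} {s : ℕ}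
    (hdeg : S.natDegree ≤ s) (hS : T′ = aeval x S) :
    ∃ c f : F, c′ = 0 ∧ c * v + f′ = S.coeff s := by
  obtain ⟨P, rfl⟩ := exists_aeval_eq_of_deriv_eq_aeval hx hv hT hS
  rw [deriv_aeval_eq_implicitDeriv x (C v) (by simpa using hv)] at hS
  obtain rfl := transcendental_iff_injective.1 hx hS
  have hP := natDegree_le_of_natDegree_implicitDeriv_le hx hv hdeg
  have hlead : (P.coeff (s + 1))′ = 0 :=
    deriv_coeff_eq_zero_of_natDegree_implicitDeriv_lt (v := v) (by lia) (by lia)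
  refine ⟨P.coeff (s + 1) * (s + 1), P.coeff s, ?_, ?_⟩
  · simp [hlead]
  · rw [coeff_implicitDeriv_C]
    ring

end PrimitiveExtension

/-- The differential structure on a subfield closed under a derivation. -/
@[reducible]
def Subfield.differential {E : Type*} [Field E] [Algebra ℚ E] (D : Derivation ℚ E E)
    (K : Subfield E) (hK : ∀ a ∈ K, D a ∈ K) : Differential K where
  deriv := Derivation.mk'
    { toFun := fun a ↦ ⟨D a, hK a a.2⟩
      map_add' := fun a b ↦ by ext; simp
      map_smul' := fun n a ↦ by ext; simp }
    (fun a b ↦ by ext; simp)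

/-- Let `K ⊆ K(x)` be an extension of differential fields of
characteristic zero with the same constants, with `x` transcendental over `K` and
`x′ ∈ K`.  Let `S = Σᵢ₌₀ˢ qᵢ xⁱ` with `qᵢ ∈ K`, `qₛ ≠ 0`.  If `c·x′ + f′ ≠ qₛ` for every
constant `c` of `K` and every `f ∈ K`, then no `T ∈ K(x)` satisfies `T′ = S`. -/
theorem no_integral_of_polynomial
    (E : Type) [Field E] [CharZero E] (D : Derivation ℚ E E)
    (K : Subfield E) (hK : ∀ a ∈ K, D a ∈ K)
    (hC : ∀ c : E, D c = 0 → c ∈ K)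
    (x : E) (hxt : Transcendental K x) (hx : D x ∈ K)
    (hgen : Subfield.closure (↑K ∪ {x}) = ⊤)
    (s : ℕ) (q : ℕ → E) (hq : ∀ i ≤ s, q i ∈ K) (hqs : q s ≠ 0)
    (hne : ∀ c f : E, c ∈ K → D c = 0 → f ∈ K → c * D x + D f ≠ q s) :
    ¬ ∃ T : E, D T = ∑ i ∈ Finset.range (s + 1), q i * x ^ i := by
  rintro ⟨T, hT⟩
  let : Differential E := ⟨D.restrictScalars ℤ⟩
  let : Differential K := K.differential D hK
  have : DifferentialAlgebra K E := ⟨fun _ ↦ rfl⟩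
  have : ContainConstants K E := ⟨fun {c} hc ↦ ⟨⟨c, hC c hc⟩, rfl⟩⟩
  have htop : (T : E) ∈ K⟮x⟯ := by
    rw [← mem_toSubfield, adjoin_toSubfield]
    have hr : Set.range (algebraMap K E) = K := Subtype.range_coe
    rw [hr, hgen]
    trivial
  let S : K[X] := ∑ i : Fin (s + 1), monomial i ⟨q i, hq i (Nat.lt_succ_iff.1 i.2)⟩
  have hdeg : S.natDegree ≤ s :=
    natDegree_sum_le_of_forall_le _ _ fun i _ ↦
      (natDegree_monomial_le _).trans (Nat.lt_succ_iff.1 i.2)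
  have hcoeff : S.coeff s = ⟨q s, hq s le_rfl⟩ := by
    rw [finsetSum_coeff, Finset.sum_eq_single (Fin.last s)]
    · simp
    · intro i _ hi
      exact coeff_monomial_of_ne _ fun h ↦ hi (Fin.ext h.symm)
    · simp
  have hS : T′ = aeval x S := by
    refine hT.trans ?_
    simp only [S, map_sum, aeval_monomial, Finset.sum_range]
    rfl
  obtain ⟨c, f, hc, h⟩ :=
    exists_coeff_eq_of_deriv_eq_aeval (v := ⟨D x, hx⟩) hxt rfl htop hdeg hS
  rw [hcoeff] at h
  exact hne c f c.2 (congrArg Subtype.val hc) f.2 (congrArg Subtype.val h)
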